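/- For every linear subspace D of ℓ^∞ admitting a countable Hamel basis and satisfying D ∩ c = {0}, there exists a (not necessarily closed) linear subspace Z of ℓ^∞ with D ⊆ Z, Z ∩ c = {0}, and the algebraic dimension of Z equal to the cardinality of the continuum 𝔠. In particular, ℓ^∞ \ c is (ℵ₀, 𝔠)-lineable. -/

import Mathlib

open Filter Topology

noncomputable section

/-- `ℓ^∞`: the Banach space of bounded real sequences with the sup norm. -/
abbrev Linfty : Type := lp (fun _ : ℕ => ℝ) ⊤

/-- `c`: the set of convergent sequences inside `ℓ^∞`. -/
def convSeq : Set Linfty := {f | ∃ l : ℝ, Tendsto (fun n => (f : ℕ → ℝ) n) atTop (𝓝 l)}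

/-- `A ⊆ ℓ^∞` is `(α, β)`-lineable: `A ∪ {0}` contains an `α`-dimensional subspace,
and every `α`-dimensional subspace contained in `A ∪ {0}` is contained in a
`β`-dimensional subspace contained in `A ∪ {0}`. -/
def IsLineable (α β : Cardinal) (A : Set Linfty) : Prop :=
  (∃ W : Submodule ℝ Linfty, Module.rank ℝ W = α ∧ (W : Set Linfty) ⊆ A ∪ {0}) ∧
  ∀ W : Submodule ℝ Linfty, Module.rank ℝ W = α → (W : Set Linfty) ⊆ A ∪ {0} →
    ∃ Z : Submodule ℝ Linfty, Module.rank ℝ Z = β ∧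
      W ≤ Z ∧ (Z : Set Linfty) ⊆ A ∪ {0}

/-- The subspace of convergent sequences of `ℓ^∞`. -/
def convSubmodule : Submodule ℝ Linfty where
  carrier := convSeq
  zero_mem' := ⟨0, tendsto_const_nhds⟩
  add_mem' := by
    rintro f g ⟨l, hl⟩ ⟨m, hm⟩
    exact ⟨l + m, hl.add hm⟩
  smul_mem' := by
    rintro a f ⟨l, hl⟩
    exact ⟨a * l, hl.const_mul a⟩

/-- The code of the initial segment of length `k` of a binary sequence `x`. -/
def branchCode (x : ℕ → Bool) (k : ℕ) : ℕ := Encodable.encode ((List.range k).map x)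

theorem branchCode_eq_iff {x y : ℕ → Bool} {k m : ℕ} :
    branchCode x k = branchCode y m ↔ k = m ∧ ∀ i < k, x i = y i := by
  rw [branchCode, branchCode, Encodable.encode_inj]
  constructor
  · intro h
    obtain rfl : k = m := by simpa using congrArg List.length h
    simpa using h
  · rintro ⟨rfl, h⟩
    simpa using h

theorem tendsto_branchCode (x : ℕ → Bool) : Tendsto (branchCode x) atTop atTop :=
  Function.Injective.nat_tendsto_atTop fun _ _ h => (branchCode_eq_iff.1 h).1

open Classical in
/-- The indicator of the set of codes of initial segments of `x`; distinct binary sequences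
give almost disjoint sets. -/
def branchIndicator (x : ℕ → Bool) : Linfty :=
  ⟨fun n => if n ∈ Set.range (branchCode x) then 1 else 0, memℓp_infty ⟨1, by
    rintro _ ⟨n, rfl⟩
    dsimp only
    split_ifs <;> simp⟩⟩

open Classical in
theorem tendsto_branchIndicator (x y : ℕ → Bool) :
    Tendsto (fun k => (branchIndicator y : ℕ → ℝ) (branchCode x k)) atTop
      (𝓝 (if y = x then 1 else 0)) := by
  refine tendsto_const_nhds.congr' ?_
  split_ifs with h
  · subst h
    exact Eventually.of_forall fun k => (if_pos ⟨k, rfl⟩).symm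
  · obtain ⟨j, hj⟩ := Function.ne_iff.1 h
    filter_upwards [eventually_gt_atTop j] with k hk
    refine (if_neg ?_).symm
    rintro ⟨m, hm⟩
    obtain ⟨rfl, hxy⟩ := branchCode_eq_iff.1 hm
    exact hj (hxy j hk)

theorem tendsto_linearCombination_branchIndicator (a : (ℕ → Bool) →₀ ℝ) (x : ℕ → Bool) :
    Tendsto (fun k => (Finsupp.linearCombination ℝ branchIndicator a : ℕ → ℝ) (branchCode x k))
      atTop (𝓝 (a x)) := by
  classical
  have h := tendsto_finsetSum a.support fun y _ =>
    (tendsto_branchIndicator x y).const_mul (a y)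
  have hx : ∑ y ∈ a.support, a y * (if y = x then (1 : ℝ) else 0) = a x := by
    simpa using Eq.symm
  rw [hx] at h
  refine h.congr fun k => ?_
  rw [Finsupp.linearCombination_apply, Finsupp.sum, lp.coeFn_sum, Finset.sum_apply]
  rfl

theorem linearIndependent_mkQ_branchIndicator :
    LinearIndependent ℝ fun x => convSubmodule.mkQ (branchIndicator x) := by
  rw [linearIndependent_iff]
  intro a ha
  have hmem : Finsupp.linearCombination ℝ branchIndicator a ∈ convSubmodule := by
    rw [← Submodule.Quotient.mk_eq_zero, ← Submodule.mkQ_apply, Finsupp.apply_linearCombination]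
    exact ha
  obtain ⟨l, hl⟩ := hmem
  have hal (x : ℕ → Bool) : a x = l :=
    tendsto_nhds_unique (tendsto_linearCombination_branchIndicator a x)
      (hl.comp (tendsto_branchCode x))
  obtain ⟨z, hz⟩ := Infinite.exists_notMem_finset a.support
  ext x
  rw [hal x, ← hal z, Finsupp.notMem_support_iff.1 hz, Finsupp.zero_apply]

theorem rank_quotient_convSubmodule :
    Module.rank ℝ (Linfty ⧸ convSubmodule) = Cardinal.continuum := by
  apply le_antisymm
  · calc Module.rank ℝ (Linfty ⧸ convSubmodule)
        ≤ Module.rank ℝ Linfty := rank_quotient_le _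
      _ ≤ Cardinal.mk Linfty := rank_le_card ℝ Linfty
      _ ≤ Cardinal.mk (ℕ → ℝ) := Cardinal.mk_le_of_injective Subtype.val_injective
      _ = Cardinal.continuum := by simp [Cardinal.mk_real]
  · simpa using linearIndependent_mkQ_branchIndicator.cardinal_le_rank

/-- A subspace meeting the convergent sequences trivially extends to one of dimension `𝔠`. -/
theorem exists_le_disjoint_rank_eq_continuum {D : Submodule ℝ Linfty}
    (hD : Disjoint D convSubmodule) :
    ∃ Z, D ≤ Z ∧ Disjoint Z convSubmodule ∧ Module.rank ℝ Z = Cardinal.continuum := by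
  obtain ⟨Z, hDZ, hZ⟩ := hD.exists_isCompl
  exact ⟨Z, hDZ, hZ.disjoint, (Submodule.quotientEquivOfIsCompl _ _ hZ.symm).rank_eq ▸
    rank_quotient_convSubmodule⟩

theorem exists_le_rank_eq {K V : Type*} [DivisionRing K] [AddCommGroup V] [Module K V]
    {Z : Submodule K V} {c : Cardinal} (hc : c ≤ Module.rank K Z) :
    ∃ W ≤ Z, Module.rank K W = c := by
  obtain ⟨s, hs, hli⟩ := le_rank_iff_exists_linearIndependent.1 hc
  refine ⟨(Submodule.span K s).map Z.subtype, Submodule.map_subtype_le _ _, ?_⟩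
  rw [LinearEquiv.rank_eq (Submodule.equivSubtypeMap Z _).symm, rank_span_set hli, hs]

theorem inter_convSeq_eq_iff_disjoint {D : Submodule ℝ Linfty} :
    (D : Set Linfty) ∩ convSeq = {0} ↔ Disjoint D convSubmodule := by
  rw [disjoint_iff, ← SetLike.coe_set_eq (p := D ⊓ convSubmodule)]
  rfl

theorem subset_diff_convSeq_iff_disjoint {D : Submodule ℝ Linfty} :
    (D : Set Linfty) ⊆ (Set.univ \ convSeq) ∪ {0} ↔ Disjoint D convSubmodule := by
  rw [Submodule.disjoint_def]
  refine forall₂_congr fun f _ => ?_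
  change (True ∧ f ∉ convSeq) ∨ f = 0 ↔ (f ∈ convSeq → f = 0)
  tauto

/-- Every subspace `D ⊆ ℓ^∞` with a countable Hamel basis and `D ∩ c = {0}` is
contained in a (not necessarily closed) subspace `Z` of algebraic dimension `𝔠` with
`Z ∩ c = {0}`; in particular `ℓ^∞ \ c` is `(ℵ₀, 𝔠)`-lineable. -/
theorem stmt14 :
    (∀ D : Submodule ℝ Linfty,
      (∃ B : Set Linfty, B.Countable ∧
        LinearIndependent ℝ ((↑) : B → Linfty) ∧ Submodule.span ℝ B = D) →
      (D : Set Linfty) ∩ convSeq = {0} →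
      ∃ Z : Submodule ℝ Linfty, D ≤ Z ∧
        (Z : Set Linfty) ∩ convSeq = {0} ∧ Module.rank ℝ Z = Cardinal.continuum) ∧
    IsLineable Cardinal.aleph0 Cardinal.continuum
      ((Set.univ : Set Linfty) \ convSeq) := by
  refine ⟨fun D _ hD => ?_, ?_, fun W _ hW => ?_⟩
  · obtain ⟨Z, hDZ, hZ, hr⟩ :=
      exists_le_disjoint_rank_eq_continuum (inter_convSeq_eq_iff_disjoint.1 hD)
    exact ⟨Z, hDZ, inter_convSeq_eq_iff_disjoint.2 hZ, hr⟩
  · obtain ⟨Z, -, hZ, hr⟩ := exists_le_disjoint_rank_eq_continuum disjoint_bot_left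
    obtain ⟨W, hWZ, hW⟩ := exists_le_rank_eq (Cardinal.aleph0_le_continuum.trans_eq hr.symm)
    exact ⟨W, hW, subset_diff_convSeq_iff_disjoint.2 (hZ.mono_left hWZ)⟩
  · obtain ⟨Z, hWZ, hZ, hr⟩ :=
      exists_le_disjoint_rank_eq_continuum (subset_diff_convSeq_iff_disjoint.1 hW)
    exact ⟨Z, hr, hWZ, subset_diff_convSeq_iff_disjoint.2 hZ⟩
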